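/- Let V be a finite-dimensional real vector space and let ω be a nonzero alternating bilinear form on V, regarded as an element of the second exterior power of the dual space V*. Let j₀(ω) be the largest natural number j such that the j-fold wedge product ω ∧ ⋯ ∧ ω (j factors) is nonzero in the exterior algebra of V*. Then the rank of ω (i.e. the rank of the induced linear map V → V*, v ↦ ω(v, ·)) equals 2·j₀(ω). -/

import Mathlib

open Module

namespace AlternatingForm

variable {K V : Type*} [Field K] [AddCommGroup V] [Module K V]

/-- The rank one alternating form `a ∧ b`, as a map into the dual. -/
def wedge (a b : Dual K V) : V →ₗ[K] Dual K V := a.smulRight b - b.smulRight a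

@[simp]
theorem wedge_apply (a b : Dual K V) (v w : V) : wedge a b v w = a v * b w - b v * a w := by
  simp [wedge]

theorem ι_mul_ι_swap (a b : Dual K V) :
    ExteriorAlgebra.ι K b * ExteriorAlgebra.ι K a =
      -(ExteriorAlgebra.ι K a * ExteriorAlgebra.ι K b) :=
  eq_neg_of_add_eq_zero_left (ExteriorAlgebra.ι_add_mul_swap b a)

theorem commute_ι_mul_ι (a b c d : Dual K V) :
    Commute (ExteriorAlgebra.ι K a * ExteriorAlgebra.ι K b)
      (ExteriorAlgebra.ι K c * ExteriorAlgebra.ι K d) := by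
  have key (e : Dual K V) : Commute (ExteriorAlgebra.ι K a * ExteriorAlgebra.ι K b)
      (ExteriorAlgebra.ι K e) := by
    rw [Commute, SemiconjBy, mul_assoc, ι_mul_ι_swap e b, mul_neg, ← mul_assoc,
      ι_mul_ι_swap e a, neg_mul, neg_neg, mul_assoc]
  exact (key c).mul_right (key d)

theorem ι_mul_ι_sq (a b : Dual K V) :
    (ExteriorAlgebra.ι K a * ExteriorAlgebra.ι K b) ^ 2 = 0 := by
  rw [sq, mul_assoc, ← mul_assoc (ExteriorAlgebra.ι K b), ι_mul_ι_swap a b, neg_mul, mul_assoc,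
    ExteriorAlgebra.ι_sq_zero, mul_zero, neg_zero, mul_zero]

/-- Interior multiplication by a vector on the exterior algebra of the dual. -/
noncomputable def interior (v : V) :
    ExteriorAlgebra K (Dual K V) →ₗ[K] ExteriorAlgebra K (Dual K V) :=
  CliffordAlgebra.contractLeft (Dual.eval K V v)

theorem interior_ι_mul (v : V) (a : Dual K V) (x : ExteriorAlgebra K (Dual K V)) :
    interior v (ExteriorAlgebra.ι K a * x) = a v • x - ExteriorAlgebra.ι K a * interior v x :=
  CliffordAlgebra.contractLeft_ι_mul _ _ _

theorem interior_ι (v : V) (a : Dual K V) :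
    interior v (ExteriorAlgebra.ι K a) = algebraMap K _ (a v) :=
  CliffordAlgebra.contractLeft_ι _ _ _

theorem interior_ι_mul_ι_mul (v : V) (a b : Dual K V) (x : ExteriorAlgebra K (Dual K V)) :
    interior v (ExteriorAlgebra.ι K a * ExteriorAlgebra.ι K b * x) =
      ExteriorAlgebra.ι K (wedge a b v) * x +
        ExteriorAlgebra.ι K a * ExteriorAlgebra.ι K b * interior v x := by
  rw [mul_assoc, interior_ι_mul, interior_ι_mul]
  simp only [wedge, LinearMap.sub_apply, LinearMap.smulRight_apply, map_sub, map_smul, mul_sub,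
    sub_mul, smul_mul_assoc, mul_smul_comm, mul_assoc]
  abel

variable {I : Type*} [Fintype I] (e : Basis I K V)

/-- The element of the exterior algebra attached to a bilinear form. -/
noncomputable def twoForm :
    (V →ₗ[K] Dual K V) →ₗ[K] ExteriorAlgebra K (Dual K V) :=
  (2 : K)⁻¹ • ∑ i, (LinearMap.mulLeft K (ExteriorAlgebra.ι K (e.coord i))) ∘ₗ
    ExteriorAlgebra.ι K ∘ₗ LinearMap.applyₗ (e i)

theorem twoForm_apply (B : V →ₗ[K] Dual K V) :
    twoForm e B =
      (2 : K)⁻¹ • ∑ i, ExteriorAlgebra.ι K (e.coord i) * ExteriorAlgebra.ι K (B (e i)) := by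
  simp [twoForm]

theorem twoForm_wedge [CharZero K] (a b : Dual K V) :
    twoForm e (wedge a b) = ExteriorAlgebra.ι K a * ExteriorAlgebra.ι K b := by
  have h (a b : Dual K V) : ∑ i, ExteriorAlgebra.ι K (e.coord i) *
      ExteriorAlgebra.ι K (a (e i) • b) = ExteriorAlgebra.ι K a * ExteriorAlgebra.ι K b := by
    conv_rhs => rw [← e.sum_dual_apply_smul_coord a]
    simp only [map_sum, map_smul, Finset.sum_mul, mul_smul_comm, smul_mul_assoc]
  rw [twoForm_apply]
  simp only [wedge, LinearMap.sub_apply, LinearMap.smulRight_apply, map_sub, mul_sub,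
    Finset.sum_sub_distrib, h]
  rw [ι_mul_ι_swap a b, sub_neg_eq_add, ← two_smul K, smul_smul, inv_mul_cancel₀ two_ne_zero,
    one_smul]

theorem commute_twoForm (B : V →ₗ[K] Dual K V) (a b : Dual K V) :
    Commute (twoForm e B) (ExteriorAlgebra.ι K a * ExteriorAlgebra.ι K b) := by
  rw [twoForm_apply]
  exact (Commute.sum_left _ _ _ fun i _ => commute_ι_mul_ι _ _ _ _).smul_left _

theorem interior_twoForm_mul [CharZero K] {B : V →ₗ[K] Dual K V} (hB : B.IsAlt) (v : V)
    (x : ExteriorAlgebra K (Dual K V)) :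
    interior v (twoForm e B * x) =
      ExteriorAlgebra.ι K (B v) * x + twoForm e B * interior v x := by
  have h : ∑ i, wedge (e.coord i) (B (e i)) v = (2 : K) • B v := by
    have h₁ : ∑ i, e.coord i v • B (e i) = B v := by
      conv_rhs => rw [← e.sum_repr v]
      simp only [map_sum, map_smul, Basis.coord_apply]
    have h₂ : ∑ i, B (e i) v • e.coord i = -B v := by
      rw [← e.sum_dual_apply_smul_coord (-B v)]
      exact Finset.sum_congr rfl fun i _ => by rw [LinearMap.neg_apply, hB.neg]
    simp only [wedge, LinearMap.sub_apply, LinearMap.smulRight_apply, Finset.sum_sub_distrib,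
      h₁, h₂]
    rw [two_smul, sub_neg_eq_add]
  simp only [twoForm_apply, smul_mul_assoc, Finset.sum_mul, map_smul, map_sum,
    interior_ι_mul_ι_mul, Finset.sum_add_distrib, smul_add]
  rw [← Finset.sum_mul, ← map_sum, h, map_smul, smul_mul_assoc, smul_smul,
    inv_mul_cancel₀ two_ne_zero, one_smul]

theorem interior_twoForm_pow_mul [CharZero K] {B : V →ₗ[K] Dual K V} (hB : B.IsAlt) {v : V} (hv : B v = 0)
    (k : ℕ) (x : ExteriorAlgebra K (Dual K V)) :
    interior v (twoForm e B ^ k * x) = twoForm e B ^ k * interior v x := by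
  induction k with
  | zero => simp
  | succ k ih =>
    rw [pow_succ', mul_assoc, interior_twoForm_mul e hB, hv, map_zero, zero_mul, zero_add, ih,
      mul_assoc]

theorem add_pow_succ_of_sq_eq_zero {A : Type*} [Semiring A] {x y : A} (h : Commute x y)
    (hy : y ^ 2 = 0) (k : ℕ) : (x + y) ^ (k + 1) = x ^ (k + 1) + (k + 1) • (x ^ k * y) := by
  induction k with
  | zero => simp
  | succ k ih =>
    have hxy : x ^ k * y * x = x ^ (k + 1) * y := by
      rw [mul_assoc, ← h.eq, ← mul_assoc, ← pow_succ]
    rw [pow_succ, ih, add_mul, mul_add, smul_mul_assoc, mul_add, hxy, mul_assoc _ y y, ← sq, hy,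
      mul_zero, add_zero, ← pow_succ, succ_nsmul _ (k + 1), add_assoc, add_comm (x ^ (k + 1) * y)]

theorem finrank_range_add_wedge [FiniteDimensional K V] {B : V →ₗ[K] Dual K V} (hB : B.IsAlt)
    {a b : Dual K V} {v w : V} (hv : B v = 0) (hw : B w = 0)
    (hav : a v = 1) (haw : a w = 0) (hbv : b v = 0) (hbw : b w = 1) :
    finrank K (LinearMap.range (B + wedge a b)) = finrank K (LinearMap.range B) + 2 := by
  have hBv (x : V) : B x v = 0 := by rw [← hB.neg, hv]; simp
  have hBw (x : V) : B x w = 0 := by rw [← hB.neg, hw]; simp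
  have hb : b ∈ LinearMap.range (B + wedge a b) :=
    ⟨v, by ext y; simp [hv, hav, hbv]⟩
  have ha : a ∈ LinearMap.range (B + wedge a b) :=
    ⟨-w, by ext y; simp [hw, haw, hbw]⟩
  have hrange : LinearMap.range (B + wedge a b) =
      LinearMap.range B ⊔ Submodule.span K (Set.range ![a, b]) := by
    apply le_antisymm
    · rintro _ ⟨x, rfl⟩
      refine Submodule.add_mem_sup ⟨x, rfl⟩ ?_
      refine Submodule.sub_mem _ (Submodule.smul_mem _ _ (Submodule.subset_span ⟨1, rfl⟩))
        (Submodule.smul_mem _ _ (Submodule.subset_span ⟨0, rfl⟩))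
    · refine sup_le ?_ (Submodule.span_le.2 ?_)
      · rintro _ ⟨x, rfl⟩
        have : B x = (B + wedge a b) x - (a x • b - b x • a) := by
          ext y; simp
        rw [this]
        exact Submodule.sub_mem _ ⟨x, rfl⟩
          (Submodule.sub_mem _ (Submodule.smul_mem _ _ hb) (Submodule.smul_mem _ _ ha))
      · rintro _ ⟨i, rfl⟩
        fin_cases i
        exacts [ha, hb]
  have hli : LinearIndependent K ![a, b] := by
    rw [LinearIndependent.pair_iff]
    intro s t hst
    constructor
    · simpa [hav, hbv] using LinearMap.congr_fun hst v
    · simpa [haw, hbw] using LinearMap.congr_fun hst w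
  have hdisj : LinearMap.range B ⊓ Submodule.span K (Set.range ![a, b]) = ⊥ := by
    rw [eq_bot_iff]
    rintro _ ⟨⟨x, rfl⟩, hx⟩
    simp only [Matrix.range_cons, Matrix.range_empty, Set.union_empty, Set.singleton_union] at hx
    obtain ⟨s, t, hst⟩ := Submodule.mem_span_pair.1 hx
    have hs : s = 0 := by simpa [hav, hbv, hBv] using LinearMap.congr_fun hst v
    have ht : t = 0 := by simpa [haw, hbw, hBw] using LinearMap.congr_fun hst w
    rw [Submodule.mem_bot, ← hst, hs, ht]
    simp
  have h := Submodule.finrank_sup_add_finrank_inf_eq (LinearMap.range B)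
    (Submodule.span K (Set.range ![a, b]))
  rw [hdisj, finrank_bot, add_zero, finrank_span_eq_card hli, Fintype.card_fin] at h
  rw [hrange, h]

theorem exists_finrank_range_eq_two_mul [CharZero K] [FiniteDimensional K V] (r : ℕ)
    {B : V →ₗ[K] Dual K V} (hB : B.IsAlt) (hr : finrank K (LinearMap.range B) = r) :
    ∃ k, r = 2 * k ∧ twoForm e B ^ k ≠ 0 ∧ twoForm e B ^ (k + 1) = 0 := by
  induction r using Nat.strong_induction_on generalizing B with
  | _ r ih =>
  by_cases h0 : B = 0
  · subst h0
    refine ⟨0, ?_, by simp, by simp⟩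
    rw [← hr, LinearMap.range_zero, finrank_bot]
  obtain ⟨v, w, hvw⟩ : ∃ v w, B v w = 1 := by
    by_contra! h
    refine h0 (LinearMap.ext fun v => LinearMap.ext fun w => ?_)
    by_contra hne
    exact h v ((B v w)⁻¹ • w) (by simpa using inv_mul_cancel₀ hne)
  have hwv : B w v = -1 := by rw [← hB.neg, hvw]
  have hvv : B v v = 0 := hB v
  have hww : B w w = 0 := hB w
  obtain ⟨a, ha⟩ : ∃ a, a = -B w := ⟨_, rfl⟩
  obtain ⟨b, hb⟩ : ∃ b, b = B v := ⟨_, rfl⟩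
  have hav : a v = 1 := by simp [ha, hwv]
  have haw : a w = 0 := by simp [ha, hww]
  have hbv : b v = 0 := by simp [hb, hvv]
  have hbw : b w = 1 := by simp [hb, hvw]
  obtain ⟨C, hC⟩ : ∃ C, C = B - wedge a b := ⟨_, rfl⟩
  have hBC : B = C + wedge a b := by ext; simp [hC]
  have hCalt : C.IsAlt := fun x => by
    have := hB x
    simp [hC, this, mul_comm]
  have hCv : C v = 0 := by ext y; rw [hC, LinearMap.sub_apply, LinearMap.sub_apply, wedge_apply, hav, hbv, hb]; simp
  have hCw : C w = 0 := by ext y; rw [hC, LinearMap.sub_apply, LinearMap.sub_apply, wedge_apply, haw, hbw, ha]; simp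
  have hrank := finrank_range_add_wedge hCalt hCv hCw hav haw hbv hbw
  rw [← hBC, hr] at hrank
  obtain ⟨k, hk, hne, hzero⟩ := ih _ (by omega) hCalt rfl
  have hform : twoForm e B =
      twoForm e C + ExteriorAlgebra.ι K a * ExteriorAlgebra.ι K b := by
    rw [hBC, map_add, twoForm_wedge]
  have hpow := add_pow_succ_of_sq_eq_zero (commute_twoForm e C a b) (ι_mul_ι_sq a b)
  refine ⟨k + 1, by omega, ?_, ?_⟩
  · rw [hform, hpow, hzero, zero_add]
    intro h
    have h' : twoForm e C ^ k * (ExteriorAlgebra.ι K a * ExteriorAlgebra.ι K b) = 0 := by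
      rw [← Nat.cast_smul_eq_nsmul K] at h
      exact (smul_eq_zero.1 h).resolve_left (Nat.cast_ne_zero.2 k.succ_ne_zero)
    have h'' := congrArg (fun x => interior w (interior v x)) h'
    simp only [map_zero, interior_twoForm_pow_mul e hCalt hCv,
      interior_twoForm_pow_mul e hCalt hCw, interior_ι_mul, interior_ι, hav, hbv, hbw, one_smul,
      mul_zero, sub_zero, map_one, mul_one] at h''
    exact hne h''
  · rw [hform, hpow, pow_succ, hzero, zero_mul, zero_mul, smul_zero, add_zero]

end AlternatingForm

theorem stmt10 (V : Type*) [AddCommGroup V] [Module ℝ V] [FiniteDimensional ℝ V]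
    (B : V →ₗ[ℝ] V →ₗ[ℝ] ℝ) (halt : ∀ v, B v v = 0) (hB : B ≠ 0)
    (ω : ExteriorAlgebra ℝ (Module.Dual ℝ V)) (n : ℕ)
    (f g : Fin n → Module.Dual ℝ V)
    (hω : ω = ∑ i, ExteriorAlgebra.ι ℝ (f i) * ExteriorAlgebra.ι ℝ (g i))
    (hmatch : ∀ v w, B v w = ∑ i, (f i v * g i w - f i w * g i v)) :
    finrank ℝ (LinearMap.range B) = 2 * sSup {j : ℕ | ω ^ j ≠ 0} := by
  let e := Module.finBasis ℝ V
  have hsum : B = ∑ i, AlternatingForm.wedge (f i) (g i) := by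
    ext v w
    simp [hmatch, LinearMap.sum_apply, mul_comm]
  have hωB : ω = AlternatingForm.twoForm e B := by
    rw [hsum, map_sum, hω]
    exact Finset.sum_congr rfl fun i _ => (AlternatingForm.twoForm_wedge e _ _).symm
  obtain ⟨k, hk, hne, hzero⟩ :=
    AlternatingForm.exists_finrank_range_eq_two_mul e _ (B := B) halt rfl
  rw [← hωB] at hne hzero
  have hgreatest : IsGreatest {j : ℕ | ω ^ j ≠ 0} k := by
    refine ⟨hne, fun j hj => ?_⟩
    by_contra! hlt
    exact hj (pow_eq_zero_of_le hlt hzero)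
  rw [hgreatest.csSup_eq, hk]
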